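/- Let ρ_{kl} : D₆ → ℂ denote the (k,l) matrix coefficient of the 2-dimensional representation ρ, let 1 denote the constant function 1 on D₆, and let χ be the sign character (χ(rᵏ) = 1, χ(s·rᵏ) = −1). Then for k = 1, 2 the spinor (ρ_{k2}, ρ_{k1}) is an eigenvector of the Dirac operator D̸ with eigenvalue +3 and (ρ_{k2}, −ρ_{k1}) is an eigenvector with eigenvalue −3; moreover (χ, 0) and (0, χ) are eigenvectors with eigenvalue +3, and (1, 0) and (0, 1) are eigenvectors with eigenvalue −3. -/

import Mathlib

noncomputable section
open DihedralGroup Complex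

abbrev D6 := DihedralGroup 6
/-- the reflection `s` -/
def s : D6 := DihedralGroup.sr 0
/-- the rotation `r` of order 6 -/
def rot : D6 := DihedralGroup.r 1
/-- `t = s*r` -/
def t : D6 := s * rot
/-- `x = s*r^3` -/
def x : D6 := s * rot ^ 3
/-- `y = s*r^5` -/
def y : D6 := s * rot ^ 5
/-- `F` is the space of complex-valued functions on `D₆`. -/
abbrev F := D6 → ℂ

/-- The right-translation operator `(R_a f)(g) = f(g·a)`. -/
def R (a : D6) : Module.End ℂ F := LinearMap.funLeft ℂ ℂ (fun g => g * a)

/-- `ω = exp(iπ/3)`. -/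
def ω : ℂ := Complex.exp (Real.pi * Complex.I / 3)

/-- `D₀ = R_t + R_x + R_y`. -/
def D₀ : Module.End ℂ F := R t + R x + R y

/-- `D₁ = ω·R_t + ω³·R_x + ω⁵·R_y`. -/
def D₁ : Module.End ℂ F := ω • R t + ω ^ 3 • R x + ω ^ 5 • R y

/-- `D₂ = ω⁻¹·R_t + ω⁻³·R_x + ω⁻⁵·R_y`. -/
def D₂ : Module.End ℂ F := ω⁻¹ • R t + (ω ^ 3)⁻¹ • R x + (ω ^ 5)⁻¹ • R y

/-- The Dirac operator `D̸(f₁, f₂) = (−D₀f₁ + D₂f₂, D₁f₁ − D₀f₂)` on `F × F`. -/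
def Dir : Module.End ℂ (F × F) :=
  LinearMap.prod (D₂ ∘ₗ LinearMap.snd ℂ F F - D₀ ∘ₗ LinearMap.fst ℂ F F)
    (D₁ ∘ₗ LinearMap.fst ℂ F F - D₀ ∘ₗ LinearMap.snd ℂ F F)

/-- The `(k,l)` matrix coefficient `ρ_{kl} : D₆ → ℂ` of a representation
`ρ : D₆ → GL₂(ℂ)` (indices in `Fin 2`: `0` is the paper's index 1, `1` is index 2). -/
def mc (ρ : D6 →* Matrix.GeneralLinearGroup (Fin 2) ℂ) (k l : Fin 2) : F :=
  fun g => (ρ g : Matrix (Fin 2) (Fin 2) ℂ) k l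

/-- The sign character `χ` of `D₆`: `χ(rᵏ) = 1`, `χ(s·rᵏ) = −1`. -/
def χ : F := fun g => match g with
  | DihedralGroup.r _ => 1
  | DihedralGroup.sr _ => -1

theorem ω_ne_zero : ω ≠ 0 := Complex.exp_ne_zero _

theorem ω_pow_three : ω ^ 3 = -1 := by
  rw [ω, ← Complex.exp_nat_mul, ← Complex.exp_pi_mul_I]
  congr 1
  push_cast
  ring

theorem ω_ne_neg_one : ω ≠ -1 := by
  intro h
  have him := congrArg Complex.im h
  have hω : ω = Complex.exp ((Real.pi / 3 : ℝ) * Complex.I) := by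
    rw [ω]
    congr 1
    push_cast
    ring
  rw [hω, Complex.exp_ofReal_mul_I_im, Real.sin_pi_div_three] at him
  simp at him

theorem ω_sq : ω ^ 2 = ω - 1 := by
  have h : (ω + 1) * (ω ^ 2 - ω + 1) = 0 := by linear_combination ω_pow_three
  rcases mul_eq_zero.mp h with h | h
  · exact absurd (eq_neg_of_add_eq_zero_left h) ω_ne_neg_one
  · linear_combination h

theorem ω_inv : ω⁻¹ = 1 - ω := by
  refine inv_eq_of_mul_eq_one_right ?_
  linear_combination -ω_sq

theorem ω_pow_five : ω ^ 5 = 1 - ω := by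
  linear_combination ω ^ 2 * ω_pow_three - ω_sq

theorem one_sub_ω_inv : (1 - ω)⁻¹ = ω := by
  rw [← ω_inv, inv_inv]

/-- A function `f` on which every reflection `s·rʲ` acts by the scalar `c`: the Dirac operator
only sees `c`, because `ω + ω³ + ω⁵ = 0`. -/
theorem Dir_eq_of_translate {f : F} {c : ℂ} (ht : R t f = c • f) (hx : R x f = c • f)
    (hy : R y f = c • f) :
    Dir (f, 0) = (-3 * c) • ((f, 0) : F × F) ∧ Dir (0, f) = (-3 * c) • ((0, f) : F × F) := by
  constructor <;> ext g <;>
    simp [Dir, D₀, D₁, D₂, ht, hx, hy, ω_inv, ω_pow_three, ω_pow_five, one_sub_ω_inv] <;> ring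

theorem R_sr_χ (i : ZMod 6) : R (sr i) χ = (-1 : ℂ) • χ := by
  ext g
  cases g <;> simp [R, χ, LinearMap.funLeft_apply]

theorem R_one (a : D6) : R a 1 = (1 : ℂ) • (1 : F) := by
  ext g
  simp [R, LinearMap.funLeft_apply]

section MatrixCoefficients

variable {ρ : D6 →* Matrix.GeneralLinearGroup (Fin 2) ℂ}

theorem coe_ρ_reflection (hr : (ρ rot : Matrix (Fin 2) (Fin 2) ℂ) = !![ω, 0; 0, ω⁻¹])
    (hs : (ρ s : Matrix (Fin 2) (Fin 2) ℂ) = !![0, 1; 1, 0]) (n : ℕ) :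
    (ρ (s * rot ^ n) : Matrix (Fin 2) (Fin 2) ℂ) = !![0, (ω ^ n)⁻¹; ω ^ n, 0] := by
  have hpow : (ρ rot : Matrix (Fin 2) (Fin 2) ℂ) ^ n = !![ω ^ n, 0; 0, (ω ^ n)⁻¹] := by
    rw [hr]
    induction n with
    | zero => simp [Matrix.one_fin_two]
    | succ n ih => rw [pow_succ, ih]; simp [pow_succ, mul_comm]
  rw [map_mul, map_pow, Units.val_mul, Units.val_pow_eq_pow_val, hpow, hs]
  simp

theorem R_mc_zero (hr : (ρ rot : Matrix (Fin 2) (Fin 2) ℂ) = !![ω, 0; 0, ω⁻¹])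
    (hs : (ρ s : Matrix (Fin 2) (Fin 2) ℂ) = !![0, 1; 1, 0]) (n : ℕ) (k : Fin 2) :
    R (s * rot ^ n) (mc ρ k 0) = ω ^ n • mc ρ k 1 := by
  ext g
  change (ρ (g * (s * rot ^ n)) : Matrix (Fin 2) (Fin 2) ℂ) k 0 = _
  rw [map_mul, Units.val_mul, coe_ρ_reflection hr hs, Matrix.mul_apply]
  simp [mc, mul_comm]

theorem R_mc_one (hr : (ρ rot : Matrix (Fin 2) (Fin 2) ℂ) = !![ω, 0; 0, ω⁻¹])
    (hs : (ρ s : Matrix (Fin 2) (Fin 2) ℂ) = !![0, 1; 1, 0]) (n : ℕ) (k : Fin 2) :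
    R (s * rot ^ n) (mc ρ k 1) = (ω ^ n)⁻¹ • mc ρ k 0 := by
  ext g
  change (ρ (g * (s * rot ^ n)) : Matrix (Fin 2) (Fin 2) ℂ) k 1 = _
  rw [map_mul, Units.val_mul, coe_ρ_reflection hr hs, Matrix.mul_apply]
  simp [mc, mul_comm]

theorem Dir_mc (hr : (ρ rot : Matrix (Fin 2) (Fin 2) ℂ) = !![ω, 0; 0, ω⁻¹])
    (hs : (ρ s : Matrix (Fin 2) (Fin 2) ℂ) = !![0, 1; 1, 0]) (k : Fin 2) (ε : ℂ) :
    Dir (mc ρ k 1, ε • mc ρ k 0) = ((3 * ε) • mc ρ k 1, (3 : ℂ) • mc ρ k 0) := by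
  have h0 : R (s * rot) (mc ρ k 0) = ω • mc ρ k 1 := by simpa using R_mc_zero hr hs 1 k
  have h1 : R (s * rot) (mc ρ k 1) = ω⁻¹ • mc ρ k 0 := by simpa using R_mc_one hr hs 1 k
  ext g <;>
    simp [Dir, D₀, D₁, D₂, t, x, y, R_mc_zero hr hs, R_mc_one hr hs, h0, h1, ω_inv,
      ω_pow_three, ω_pow_five, one_sub_ω_inv]
  · linear_combination (-2 * ε * mc ρ k 1 g) * ω_sq
  · linear_combination (-2 * mc ρ k 0 g) * ω_sq

end MatrixCoefficients

/-- For `ρ` the 2-dimensional representation of `D₆` and each `k`, the spinor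
`(ρ_{k2}, ρ_{k1})` is an eigenvector of `D̸` with eigenvalue `+3` and `(ρ_{k2}, −ρ_{k1})`
one with eigenvalue `−3`; moreover `(χ, 0)` and `(0, χ)` are eigenvectors with eigenvalue
`+3`, and `(1, 0)` and `(0, 1)` are eigenvectors with eigenvalue `−3`. -/
theorem eigenmodes (ρ : D6 →* Matrix.GeneralLinearGroup (Fin 2) ℂ)
    (hr : (ρ rot : Matrix (Fin 2) (Fin 2) ℂ) = !![ω, 0; 0, ω⁻¹])
    (hs : (ρ s : Matrix (Fin 2) (Fin 2) ℂ) = !![0, 1; 1, 0]) :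
    (∀ k : Fin 2,
      Dir (mc ρ k 1, mc ρ k 0) = (3 : ℂ) • (mc ρ k 1, mc ρ k 0) ∧
      Dir (mc ρ k 1, -mc ρ k 0) = (-3 : ℂ) • (mc ρ k 1, -mc ρ k 0)) ∧
    Dir (χ, 0) = (3 : ℂ) • ((χ, 0) : F × F) ∧
    Dir (0, χ) = (3 : ℂ) • ((0, χ) : F × F) ∧
    Dir (1, 0) = (-3 : ℂ) • ((1, 0) : F × F) ∧
    Dir (0, 1) = (-3 : ℂ) • ((0, 1) : F × F) := by
  have hone := Dir_eq_of_translate (R_one t) (R_one x) (R_one y)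
  have hχ := Dir_eq_of_translate (R_sr_χ _ : R t χ = _) (R_sr_χ _ : R x χ = _)
    (R_sr_χ _ : R y χ = _)
  norm_num only [mul_one, mul_neg, neg_neg] at hone hχ
  refine ⟨fun k => ⟨?_, ?_⟩, hχ.1, hχ.2, hone.1, hone.2⟩
  · simpa using Dir_mc hr hs k 1
  · simpa using Dir_mc hr hs k (-1)
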